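/- Let T be a finite tree that is not isomorphic to the spider S_{2,2,1}, i.e., the 6-vertex tree obtained from a path on 5 vertices by attaching one additional leaf to the middle vertex of the path. Then the limb numbers satisfy ℓ_1(T) + ℓ_3(T) ≥ ℓ_2(T) + ℓ_4(T). -/

import Mathlib

/-- The limb number `ℓ_k(T)`: the number of pairs `(v, T')` where `v` is a vertex of `T`
and `T'` is a connected component (given by its vertex set) with exactly `k` vertices
of the forest `T ∖ v` obtained by deleting `v` from `T`. -/
noncomputable def limbNumber {V : Type*} [Fintype V] (G : SimpleGraph V) (k : ℤ) : ℕ :=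
  Set.ncard {p : V × Set V |
    (∃ c : (G.induce ({p.1}ᶜ : Set V)).ConnectedComponent, p.2 = Subtype.val '' c.supp)
    ∧ (p.2.ncard : ℤ) = k}

/-- The spider `S_{2,2,1}`: the 6-vertex tree obtained from a path on 5 vertices
(`0 - 1 - 2 - 3 - 4`) by attaching one additional leaf (`5`) to the middle vertex `2`. -/
def spider221 : SimpleGraph (Fin 6) :=
  SimpleGraph.fromEdgeSet {s(0, 1), s(1, 2), s(2, 3), s(3, 4), s(2, 5)}

namespace SimpleGraph

variable {V : Type*} {G : SimpleGraph V}

section Branch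

variable (G) in
/-- The vertices lying on the side of `u` of an edge `v u` of a tree. -/
def branch (v u : V) : Set V := {x | G.dist x u < G.dist x v}

lemma mem_branch {v u x : V} : x ∈ G.branch v u ↔ G.dist x u < G.dist x v := Iff.rfl

lemma notMem_branch_self (v u : V) : v ∉ G.branch v u := by
  simp [mem_branch]

lemma Adj.mem_branch {v u : V} (h : G.Adj v u) : u ∈ G.branch v u := by
  simp [SimpleGraph.mem_branch, dist_eq_one_iff_adj.2 h.symm]

lemma IsTree.compl_branch (hG : G.IsTree) {v u : V} (h : G.Adj v u) :
    (G.branch v u)ᶜ = G.branch u v := by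
  ext x
  have := hG.dist_ne_of_adj x h
  simp only [Set.mem_compl_iff, mem_branch]
  omega

lemma Connected.exists_adj_mem_branch (hG : G.Connected) {v x : V} (hx : x ≠ v) :
    ∃ u, G.Adj v u ∧ x ∈ G.branch v u := by
  obtain ⟨p, hp⟩ := hG.exists_walk_length_eq_dist v x
  cases p with
  | nil => exact absurd rfl hx
  | @cons _ u _ h q =>
    refine ⟨u, h, ?_⟩
    have := dist_le q
    rw [mem_branch, dist_comm, G.dist_comm (u := x)]
    simp only [Walk.length_cons] at hp
    omega

lemma IsTree.eq_of_mem_branch (hG : G.IsTree) {v u u' x : V} (h : G.Adj v u) (h' : G.Adj v u')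
    (hx : x ∈ G.branch v u) (hx' : x ∈ G.branch v u') : u = u' := by
  have key : ∀ {w : V} (hw : G.Adj v w), x ∈ G.branch v w →
      ∃ q : G.Walk w x, (Walk.cons hw q).IsPath := by
    intro w hw hxw
    obtain ⟨q, hq⟩ := hG.connected.exists_walk_length_eq_dist w x
    refine ⟨q, Walk.isPath_of_length_eq_dist _ ?_⟩
    have h1 := hG.dist_eq_dist_add_one_of_adj x hw
    rw [mem_branch] at hxw
    rw [Walk.length_cons, hq, dist_comm, G.dist_comm (u := v)]
    omega
  obtain ⟨q, hq⟩ := key h hx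
  obtain ⟨q', hq'⟩ := key h' hx'
  have := congrArg Walk.snd ((hG.existsUnique_path v x).unique hq hq')
  simpa using this

lemma IsTree.mem_branch_iff_of_adj (hG : G.IsTree) {v u x y : V} (h : G.Adj v u)
    (hx : x ≠ v) (hy : y ≠ v) (hxy : G.Adj x y) : x ∈ G.branch v u ↔ y ∈ G.branch v u := by
  have key : ∀ {x y w : V}, G.Adj v w → G.Adj x y → G.dist v y = G.dist v x + 1 →
      x ∈ G.branch v w → y ∈ G.branch v w := by
    intro x y w hw hxy hd hxw
    have h1 := hG.dist_eq_dist_add_one_of_adj w hxy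
    rw [mem_branch] at hxw ⊢
    rw [G.dist_comm (v := w), G.dist_comm (v := v)] at hxw ⊢
    omega
  have far : ∀ {x y : V}, x ≠ v → G.Adj x y → G.dist v y = G.dist v x + 1 →
      (x ∈ G.branch v u ↔ y ∈ G.branch v u) := by
    intro x y hx hxy hd
    refine ⟨key h hxy hd, fun hyu ↦ ?_⟩
    obtain ⟨w, hw, hxw⟩ := hG.connected.exists_adj_mem_branch hx
    rwa [hG.eq_of_mem_branch h hw hyu (key hw hxy hd hxw)]
  rcases hG.dist_eq_dist_add_one_of_adj v hxy with hd | hd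
  · exact (far hy hxy.symm hd).symm
  · exact far hx hxy hd

lemma IsTree.reachable_induce_iff_mem_branch (hG : G.IsTree) {v u : V} (h : G.Adj v u)
    (x : ({v}ᶜ : Set V)) :
    (G.induce ({v}ᶜ : Set V)).Reachable x ⟨u, h.ne'⟩ ↔ x.1 ∈ G.branch v u := by
  constructor
  · rintro ⟨p⟩
    suffices ∀ (y z : ({v}ᶜ : Set V)), (G.induce ({v}ᶜ : Set V)).Walk y z →
        z.1 ∈ G.branch v u → y.1 ∈ G.branch v u from this _ _ p h.mem_branch
    intro y z p hz
    induction p with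
    | nil => exact hz
    | @cons a b _ hab _ ih => exact (hG.mem_branch_iff_of_adj h a.2 b.2 hab).2 (ih hz)
  · obtain ⟨x, hxv⟩ := x
    intro hx
    dsimp only at hx
    induction hn : G.dist x u generalizing x with
    | zero =>
      obtain rfl := hG.connected.dist_eq_zero_iff.1 hn
      rfl
    | succ n ih =>
      obtain ⟨p, hp⟩ := hG.connected.exists_walk_length_eq_dist x u
      cases p with
      | nil => simp at hn
      | @cons _ y _ hxy q =>
        have hq := dist_le q
        rw [Walk.length_cons, hn] at hp
        have h1 := hG.dist_eq_dist_add_one_of_adj u hxy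
        have h2 := hG.dist_eq_dist_add_one_of_adj v hxy
        rw [mem_branch] at hx
        rw [G.dist_comm (u := u), G.dist_comm (u := u)] at h1
        rw [G.dist_comm (u := v), G.dist_comm (u := v)] at h2
        have hy : y ∈ G.branch v u := by rw [mem_branch]; omega
        have hyv : y ≠ v := fun hyv ↦ notMem_branch_self v u (hyv ▸ hy)
        exact Reachable.trans (Adj.reachable (by exact hxy)) (ih y hyv hy (by omega))

lemma IsTree.image_supp_connectedComponentMk (hG : G.IsTree) {v u : V} (h : G.Adj v u) :
    Subtype.val '' ((G.induce ({v}ᶜ : Set V)).connectedComponentMk ⟨u, h.ne'⟩).supp =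
      G.branch v u := by
  ext x
  constructor
  · rintro ⟨y, hy, rfl⟩
    exact (hG.reachable_induce_iff_mem_branch h y).1 (ConnectedComponent.exact hy)
  · intro hx
    have hxv : x ≠ v := fun hxv ↦ notMem_branch_self v u (hxv ▸ hx)
    exact ⟨⟨x, hxv⟩, ConnectedComponent.sound
      ((hG.reachable_induce_iff_mem_branch h ⟨x, hxv⟩).2 hx), rfl⟩

/-- The components of `G ∖ v` are the branches at `v`. -/
lemma IsTree.exists_eq_image_supp_iff (hG : G.IsTree) {v : V} {s : Set V} :
    (∃ c : (G.induce ({v}ᶜ : Set V)).ConnectedComponent, s = Subtype.val '' c.supp) ↔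
      ∃ u, G.Adj v u ∧ s = G.branch v u := by
  constructor
  · rintro ⟨c, rfl⟩
    induction c using ConnectedComponent.ind with
    | h x =>
      obtain ⟨u, hu, hx⟩ := hG.connected.exists_adj_mem_branch x.2
      refine ⟨u, hu, ?_⟩
      rw [← hG.image_supp_connectedComponentMk hu,
        ConnectedComponent.sound ((hG.reachable_induce_iff_mem_branch hu x).2 hx)]
  · rintro ⟨u, hu, rfl⟩
    exact ⟨_, (hG.image_supp_connectedComponentMk hu).symm⟩

end Branch

section Size

variable (G) in
/-- The number of vertices on the side of `u` of an edge `v u` of a tree. -/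
noncomputable def branchSize (v u : V) : ℕ := (G.branch v u).ncard

variable [Fintype V]

lemma Adj.branchSize_pos {v u : V} (h : G.Adj v u) : 0 < G.branchSize v u :=
  (Set.ncard_pos).2 ⟨u, h.mem_branch⟩

lemma IsTree.branchSize_add_branchSize (hG : G.IsTree) {v u : V} (h : G.Adj v u) :
    G.branchSize v u + G.branchSize u v = Fintype.card V := by
  rw [branchSize, branchSize, ← hG.compl_branch h, Set.ncard_add_ncard_compl,
    Nat.card_eq_fintype_card]

open Classical in
lemma IsTree.sum_branchSize_add_one (hG : G.IsTree) (v : V) :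
    ∑ u ∈ G.neighborFinset v, G.branchSize v u + 1 = Fintype.card V := by
  have hU : (Finset.univ : Finset V).erase v =
      (G.neighborFinset v).biUnion fun u ↦ (G.branch v u).toFinset := by
    ext x
    simp only [Finset.mem_erase, Finset.mem_univ, and_true, Finset.mem_biUnion,
      mem_neighborFinset, Set.mem_toFinset]
    refine ⟨fun hx ↦ hG.connected.exists_adj_mem_branch hx, ?_⟩
    rintro ⟨u, -, hx⟩ rfl
    exact notMem_branch_self _ _ hx
  have hc := congrArg Finset.card hU
  rw [Finset.card_biUnion, Finset.card_erase_of_mem (Finset.mem_univ v), Finset.card_univ] at hc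
  · have : 0 < Fintype.card V := Fintype.card_pos_iff.2 ⟨v⟩
    simp only [branchSize, Set.ncard_eq_toFinset_card']
    omega
  · intro u hu u' hu' hne
    rw [Finset.mem_coe, mem_neighborFinset] at hu hu'
    refine Finset.disjoint_left.2 ?_
    intro x hx hx'
    rw [Set.mem_toFinset] at hx hx'
    exact hne (hG.eq_of_mem_branch hu hu' hx hx')

open Classical in
lemma IsTree.branchSize_eq_sum_add_one (hG : G.IsTree) {w v : V} (h : G.Adj w v) :
    G.branchSize w v = ∑ u ∈ (G.neighborFinset v).erase w, G.branchSize v u + 1 := by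
  have h1 := hG.sum_branchSize_add_one v
  have h2 := hG.branchSize_add_branchSize h
  have h3 := Finset.add_sum_erase (G.neighborFinset v) (G.branchSize v)
    ((mem_neighborFinset ..).2 h.symm)
  omega

lemma IsTree.exists_odd_branchSize (hG : G.IsTree) {w v : V} (h : G.Adj w v)
    (he : Even (G.branchSize w v)) :
    ∃ u, G.Adj v u ∧ u ≠ w ∧ Odd (G.branchSize v u) ∧ G.branchSize v u < G.branchSize w v := by
  classical
  have hs := hG.branchSize_eq_sum_add_one h
  obtain ⟨u, hu, hodd⟩ : ∃ u ∈ (G.neighborFinset v).erase w, Odd (G.branchSize v u) := by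
    by_contra! hc
    have := Finset.even_sum _ fun u hu ↦ Nat.not_odd_iff_even.1 (hc u hu)
    grind
  have hle := Finset.single_le_sum (f := G.branchSize v) (fun _ _ ↦ Nat.zero_le _) hu
  rw [Finset.mem_erase, mem_neighborFinset] at hu
  exact ⟨u, hu.2, hu.1, hodd, by omega⟩

lemma IsTree.branchSize_add_add_lt (hG : G.IsTree) {v a b c : V} (ha : G.Adj v a)
    (hb : G.Adj v b) (hc : G.Adj v c) (hab : a ≠ b) (hac : a ≠ c) (hbc : b ≠ c) :
    G.branchSize v a + G.branchSize v b + G.branchSize v c < Fintype.card V := by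
  classical
  have h1 := hG.sum_branchSize_add_one v
  have h2 : ∑ u ∈ {a, b, c}, G.branchSize v u ≤ ∑ u ∈ G.neighborFinset v, G.branchSize v u :=
    Finset.sum_le_sum_of_subset (by simp [Finset.insert_subset_iff, ha, hb, hc])
  rw [Finset.sum_insert (by simp [hab, hac]), Finset.sum_pair hbc] at h2
  omega

lemma IsTree.exists_adj_ne_mem_branch (hG : G.IsTree) {v w : V} (h : G.Adj v w)
    (h2 : 2 ≤ G.branchSize v w) : ∃ x, G.Adj w x ∧ x ∈ G.branch v w := by
  classical
  have hs := hG.branchSize_eq_sum_add_one h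
  obtain ⟨x, hx⟩ : ((G.neighborFinset w).erase v).Nonempty := by
    by_contra hc
    rw [Finset.not_nonempty_iff_eq_empty] at hc
    simp [hc] at hs
    omega
  rw [Finset.mem_erase, mem_neighborFinset] at hx
  exact ⟨x, hx.2, (hG.mem_branch_iff_of_adj h h.ne' hx.1 hx.2).1 h.mem_branch⟩

open Classical in
lemma IsTree.limbNumber_eq_card (hG : G.IsTree) (k : ℕ) :
    limbNumber G k = (Finset.univ.filter fun d : G.Dart ↦ G.branchSize d.fst d.snd = k).card := by
  let f : G.Dart → V × Set V := fun d ↦ (d.fst, G.branch d.fst d.snd)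
  have hf : Function.Injective f := by
    rintro ⟨⟨v, u⟩, h⟩ ⟨⟨v', u'⟩, h'⟩ heq
    simp only [f, Prod.mk.injEq] at heq
    obtain ⟨rfl, heq⟩ := heq
    have := hG.eq_of_mem_branch h h' (Adj.mem_branch h) (heq ▸ Adj.mem_branch h)
    simp only at this
    subst this
    rfl
  rw [limbNumber, ← Set.ncard_coe_finset, ← Set.ncard_image_of_injective _ hf]
  congr 1
  ext ⟨v, s⟩
  simp only [Set.mem_ofPred_eq, hG.exists_eq_image_supp_iff, Set.mem_image, Finset.coe_filter,
    Finset.mem_univ, true_and, f, Prod.mk.injEq]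
  constructor
  · rintro ⟨⟨u, hu, rfl⟩, hk⟩
    exact ⟨⟨(v, u), hu⟩, by exact_mod_cast hk, rfl, rfl⟩
  · rintro ⟨⟨⟨v, u⟩, hu⟩, hk, rfl, rfl⟩
    exact ⟨⟨u, hu, rfl⟩, by exact_mod_cast hk⟩

lemma IsTree.limbNumber_eq_of_add_eq (hG : G.IsTree) {j k : ℕ} (hjk : j + k = Fintype.card V) :
    limbNumber G j = limbNumber G k := by
  classical
  rw [hG.limbNumber_eq_card, hG.limbNumber_eq_card]
  refine Finset.card_equiv (Function.Involutive.toPerm _ Dart.symm_involutive) fun d ↦ ?_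
  have := hG.branchSize_add_branchSize d.adj
  simp only [Finset.mem_filter, Finset.mem_univ, true_and, Function.Involutive.coe_toPerm]
  change _ ↔ G.branchSize d.snd d.fst = k
  omega

end Size

lemma spider221_connected : spider221.Connected := by
  have h : ∀ i, spider221.Reachable i 2 := by
    have h01 : spider221.Adj 0 1 := by simp [spider221]
    have h12 : spider221.Adj 1 2 := by simp [spider221]
    have h32 : spider221.Adj 3 2 := by simp [spider221]
    have h43 : spider221.Adj 4 3 := by simp [spider221]
    have h52 : spider221.Adj 5 2 := by simp [spider221]
    intro i
    fin_cases i
    · exact h01.reachable.trans h12.reachable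
    · exact h12.reachable
    · rfl
    · exact h32.reachable
    · exact h43.reachable.trans h32.reachable
    · exact h52.reachable
  exact ⟨fun i j ↦ (h i).trans (h j).symm⟩

/-- A tree on the vertex set of a connected spanning subgraph coincides with it. -/
lemma IsTree.nonempty_iso_of_bijective_hom {W : Type*} {H : SimpleGraph W} (hG : G.IsTree)
    (hH : H.Connected) (f : H →g G) (hf : Function.Bijective f) : Nonempty (G ≃g H) := by
  let e := Equiv.ofBijective f hf
  have hle : H.map e ≤ G := by
    rintro _ _ ⟨-, a, b, hab, rfl, rfl⟩
    exact f.map_adj hab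
  have hc : (H.map e).Connected := (Iso.map e H).connected_iff.1 hH
  have heq : H.map e = G :=
    le_antisymm hle ((isTree_iff_minimal_connected.1 hG).2 hc hle)
  exact heq ▸ ⟨(Iso.map e H).symm⟩

lemma IsTree.nonempty_iso_spider221 [Fintype V] (hG : G.IsTree) (hn : Fintype.card V = 6)
    {v w w' u : V} (hw : G.Adj v w) (hw' : G.Adj v w') (hu : G.Adj v u) (hww' : w ≠ w')
    (hwu : w ≠ u) (hwu' : w' ≠ u) (h2 : 2 ≤ G.branchSize v w) (h2' : 2 ≤ G.branchSize v w') :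
    Nonempty (G ≃g spider221) := by
  obtain ⟨x, hx, hxB⟩ := hG.exists_adj_ne_mem_branch hw h2
  obtain ⟨x', hx', hxB'⟩ := hG.exists_adj_ne_mem_branch hw' h2'
  have sep : ∀ {a b y z : V}, G.Adj v a → G.Adj v b → a ≠ b →
      y ∈ G.branch v a → z ∈ G.branch v b → y ≠ z := by
    rintro a b y _ ha hb hab hy hz rfl
    exact hab (hG.eq_of_mem_branch ha hb hy hz)
  have hv : ∀ {a y : V}, y ∈ G.branch v a → y ≠ v := fun hy h ↦ notMem_branch_self _ _ (h ▸ hy)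
  have n1 := sep hw hw' hww' hxB hxB'
  have n2 := sep hw hw' hww' hxB hw'.mem_branch
  have n3 := sep hw hw' hww' hw.mem_branch hxB'
  have n4 := sep hw hu hwu hxB hu.mem_branch
  have n5 := sep hw' hu hwu' hxB' hu.mem_branch
  have n6 := hv hxB
  have n7 := hv hxB'
  have hinj : Function.Injective ![x, w, v, w', x', u] := by
    have m1 := hw.ne
    have m2 := hw'.ne
    have m3 := hu.ne
    have m4 := hx.ne
    have m5 := hx'.ne
    intro i j
    fin_cases i <;> fin_cases j <;> simp <;> grind
  let f : spider221 →g G := ⟨![x, w, v, w', x', u], by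
    intro a b hab
    simp only [spider221, fromEdgeSet_adj, Set.mem_insert_iff, Set.mem_singleton_iff,
      Sym2.eq_iff] at hab
    obtain ⟨hab, -⟩ := hab
    rcases hab with h | h | h | h | h <;> rcases h with ⟨rfl, rfl⟩ | ⟨rfl, rfl⟩ <;>
      simp [hx, hx', hw, hw', hu, hx.symm, hx'.symm, hw.symm, hw'.symm, hu.symm]⟩
  exact hG.nonempty_iso_of_bijective_hom spider221_connected f
    ((Fintype.bijective_iff_injective_and_card _).2 ⟨hinj, by simp [hn]⟩)

end SimpleGraph

open SimpleGraph

theorem stmt_4 {V : Type*} [Fintype V] (G : SimpleGraph V) (hG : G.IsTree)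
    (h : IsEmpty (G ≃g spider221)) :
    limbNumber G 2 + limbNumber G 4 ≤ limbNumber G 1 + limbNumber G 3 := by
  classical
  by_cases h5 : Fintype.card V = 5
  · have h1 := hG.limbNumber_eq_of_add_eq (j := 1) (k := 4) (by omega)
    have h2 := hG.limbNumber_eq_of_add_eq (j := 2) (k := 3) (by omega)
    push_cast at h1 h2
    omega
  have hcard : ∀ {i j : ℕ}, i ≠ j → limbNumber G i + limbNumber G j = (Finset.univ.filter
      fun d : G.Dart ↦ G.branchSize d.fst d.snd = i ∨ G.branchSize d.fst d.snd = j).card := by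
    intro i j hij
    rw [hG.limbNumber_eq_card, hG.limbNumber_eq_card, Finset.filter_or,
      Finset.card_union_of_disjoint]
    exact Finset.disjoint_filter.2 fun d _ hi hj ↦ hij (hi.symm.trans hj)
  have h24 := hcard (i := 2) (j := 4) (by decide)
  have h13 := hcard (i := 1) (j := 3) (by decide)
  push_cast at h24 h13
  rw [h24, h13]
  have hchild : ∀ d : G.Dart, ∃ c : G.Dart, Even (G.branchSize d.fst d.snd) →
      c.fst = d.snd ∧ c.snd ≠ d.fst ∧ Odd (G.branchSize c.fst c.snd) ∧
        G.branchSize c.fst c.snd < G.branchSize d.fst d.snd := by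
    intro d
    by_cases he : Even (G.branchSize d.fst d.snd)
    · obtain ⟨u, hu, hne, ho, hlt⟩ := hG.exists_odd_branchSize d.adj he
      exact ⟨⟨(d.snd, u), hu⟩, fun _ ↦ ⟨rfl, hne, ho, hlt⟩⟩
    · exact ⟨d, fun h ↦ absurd h he⟩
  choose c hc using hchild
  have heven : ∀ {m : ℕ}, m = 2 ∨ m = 4 → Even m := by
    rintro m (rfl | rfl) <;> decide
  refine Finset.card_le_card_of_injOn c ?_ ?_
  · intro d hd
    simp only [Finset.coe_filter, Finset.mem_univ, true_and, Set.mem_ofPred_eq] at hd ⊢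
    obtain ⟨-, -, ⟨m, hm⟩, hlt⟩ := hc d (heven hd)
    omega
  · intro d hd d' hd' hcc
    simp only [Finset.coe_filter, Finset.mem_univ, true_and, Set.mem_ofPred_eq] at hd hd'
    obtain ⟨hv, hu, ⟨m, hm⟩, -⟩ := hc d (heven hd)
    obtain ⟨hv', hu', -, -⟩ := hc d' (heven hd')
    rw [← hcc] at hv' hu'
    generalize c d = e at *
    obtain ⟨⟨w, v⟩, hw⟩ := d
    obtain ⟨⟨w', v'⟩, hw'⟩ := d'
    obtain ⟨⟨v'', u⟩, hvu⟩ := e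
    dsimp only at *
    subst hv
    subst hv'
    by_contra hne
    have hww' : w ≠ w' := by
      rintro rfl
      exact hne rfl
    have b1 := hG.branchSize_add_branchSize hw
    have b2 := hG.branchSize_add_branchSize hw'
    have b3 := hG.branchSize_add_add_lt hw.symm hw'.symm hvu hww' hu.symm hu'.symm
    have p1 := Adj.branchSize_pos hw.symm
    have p2 := Adj.branchSize_pos hw'.symm
    dsimp only at hd hd' hm b1 b2 b3 p1 p2
    have q1 : 2 ≤ G.branchSize v'' w := by omega
    have q2 : 2 ≤ G.branchSize v'' w' := by omega
    exact (not_nonempty_iff.2 h) (hG.nonempty_iso_spider221 (by omega) hw.symm hw'.symm hvu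
      hww' hu.symm hu'.symm q1 q2)
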